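/- arXiv:1503.04396 — 3 statements merged into one kernel-verified Lean document; each statement's English description precedes it below -/
import Mathlib

section
/- Let β, r, d, c ∈ ℝ with c ≠ 0 and d³ - βd + 2r = 0, and let w : ℝ → ℝ be twice continuously differentiable with w'(0) = 0, satisfying for all s ∈ ℝ: (w'(s))² = -8w(s)³ + 4βw(s)² - 4(r² + c²), w''(s) = -12w(s)² + 4βw(s), and d·w(s) - r ≠ 0. Then for every y ∈ ℝ, ∫₀^y [ d·c/(d·w(s) - r) + c·(-4dr + 4(-d² + 2β/3)·w(s))/((w'(s))² + 4c²) ] ds = (1/3)·arctan( w'(y) / (2c) ). -/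
/-- The combined monodromy integrand integrates to `(1/3)arctan(w'(y)/(2c))`:
for `w` the conformal factor with `w'(0) = 0`, `d³ - βd + 2r = 0`, `c ≠ 0`,
`(w')² = -8w³ + 4βw² - 4(r² + c²)`, `w'' = -12w² + 4βw` and `dw - r ≠ 0`. -/
theorem stmt_15 (β r d c : ℝ) (hc : c ≠ 0) (hcubic : d ^ 3 - β * d + 2 * r = 0)
    (w w' w'' : ℝ → ℝ)
    (hw : ∀ s, HasDerivAt w (w' s) s) (hw' : ∀ s, HasDerivAt w' (w'' s) s)
    (hw''cont : Continuous w'')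
    (h0 : w' 0 = 0)
    (hfirst : ∀ s, (w' s) ^ 2 = -8 * (w s) ^ 3 + 4 * β * (w s) ^ 2 - 4 * (r ^ 2 + c ^ 2))
    (hsecond : ∀ s, w'' s = -12 * (w s) ^ 2 + 4 * β * w s)
    (hne : ∀ s, d * w s - r ≠ 0) :
    ∀ y : ℝ,
      ∫ s in (0 : ℝ)..y,
        (d * c / (d * w s - r)
          + c * (-4 * d * r + 4 * (-d ^ 2 + 2 * β / 3) * w s) / ((w' s) ^ 2 + 4 * c ^ 2))
      = (1 / 3) * Real.arctan (w' y / (2 * c)) := by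
  intro y
  have hpos : ∀ s, 0 < (w' s) ^ 2 + 4 * c ^ 2 := fun s => by positivity
  have hintegrand : ∀ s,
      d * c / (d * w s - r)
          + c * (-4 * d * r + 4 * (-d ^ 2 + 2 * β / 3) * w s) / ((w' s) ^ 2 + 4 * c ^ 2)
        = 2 * c / 3 * w'' s / ((w' s) ^ 2 + 4 * c ^ 2) := by
    intro s
    have hQ := (hpos s).ne'
    have hfactor : d * ((w' s) ^ 2 + 4 * c ^ 2)
        = (d * w s - r) * (-8 * w s ^ 2 + 4 * d ^ 2 * w s + 4 * d * r) := by
      rw [hfirst s]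
      linear_combination (-4 * w s ^ 2) * hcubic
    have hpole : d * c / (d * w s - r)
        = c * (-8 * w s ^ 2 + 4 * d ^ 2 * w s + 4 * d * r) / ((w' s) ^ 2 + 4 * c ^ 2) := by
      rw [div_eq_div_iff (hne s) hQ]
      linear_combination c * hfactor
    rw [hpole, ← add_div, hsecond s]
    ring
  have hderiv : ∀ s, HasDerivAt (fun t => (1 / 3) * Real.arctan (w' t / (2 * c)))
      (2 * c / 3 * w'' s / ((w' s) ^ 2 + 4 * c ^ 2)) s := by
    intro s
    have hQ := (hpos s).ne'
    refine (((hw' s).div_const (2 * c)).arctan.const_mul (1 / 3 : ℝ)).congr_deriv ?_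
    have hscale : 1 + (w' s / (2 * c)) ^ 2 = ((w' s) ^ 2 + 4 * c ^ 2) / (4 * c ^ 2) := by
      field_simp
      ring
    rw [hscale]
    field_simp
    ring
  have hw'cont : Continuous w' :=
    continuous_iff_continuousAt.2 fun s => (hw' s).continuousAt
  have hcont : Continuous fun s => 2 * c / 3 * w'' s / ((w' s) ^ 2 + 4 * c ^ 2) :=
    (continuous_const.mul hw''cont).div ((hw'cont.pow 2).add continuous_const)
      fun s => (hpos s).ne'
  simp_rw [hintegrand]
  rw [intervalIntegral.integral_eq_sub_of_hasDerivAt (fun s _ => hderiv s)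
    (hcont.intervalIntegrable 0 y)]
  simp [h0]
end

section
/- Let β, r, d, c ∈ ℝ with c ≠ 0 and d³ - βd + 2r = 0, and let w : ℝ → ℝ be twice continuously differentiable with w'(0) = 0, satisfying for all s ∈ ℝ: (w'(s))² = -8w(s)³ + 4βw(s)² - 4(r² + c²), w''(s) = -12w(s)² + 4βw(s), and d·w(s) - r ≠ 0. If L ∈ ℝ satisfies w'(L) = 0, then ∫₀^L [ d·c/(d·w(s) - r) + c·(-4dr + 4(-d² + 2β/3)·w(s))/((w'(s))² + 4c²) ] ds = 0. -/
/-- The closing (monodromy) theorem: under the hypotheses of the explicit Iwasawa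
decomposition (`d³ - βd + 2r = 0`, `c ≠ 0`, `w'(0) = 0`, first integral and second-order
equations for `w`, and `dw - r ≠ 0`), if `w'(L) = 0` then the combined monodromy integral
over `[0, L]` vanishes. -/
theorem stmt_16 (β r d c : ℝ) (hc : c ≠ 0) (hcubic : d ^ 3 - β * d + 2 * r = 0)
    (w w' w'' : ℝ → ℝ)
    (hw : ∀ s, HasDerivAt w (w' s) s) (hw' : ∀ s, HasDerivAt w' (w'' s) s)
    (hw''cont : Continuous w'')
    (h0 : w' 0 = 0)
    (hfirst : ∀ s, (w' s) ^ 2 = -8 * (w s) ^ 3 + 4 * β * (w s) ^ 2 - 4 * (r ^ 2 + c ^ 2))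
    (hsecond : ∀ s, w'' s = -12 * (w s) ^ 2 + 4 * β * w s)
    (hne : ∀ s, d * w s - r ≠ 0)
    (L : ℝ) (hL : w' L = 0) :
    ∫ s in (0 : ℝ)..L,
      (d * c / (d * w s - r)
        + c * (-4 * d * r + 4 * (-d ^ 2 + 2 * β / 3) * w s) / ((w' s) ^ 2 + 4 * c ^ 2))
    = 0 := by
  have hQ : ∀ s, (w' s) ^ 2 + 4 * c ^ 2 ≠ 0 := fun s => by positivity
  have hfactor : ∀ s, d * ((w' s) ^ 2 + 4 * c ^ 2)
      = (d * w s - r) * (-8 * (w s) ^ 2 + 4 * d ^ 2 * w s + 4 * d * r) := fun s => by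
    rw [hfirst s]
    linear_combination (-4 * (w s) ^ 2) * hcubic
  have hprim : ∀ s, HasDerivAt (fun s => Real.arctan (w' s / (2 * c)) / 3)
      (d * c / (d * w s - r)
        + c * (-4 * d * r + 4 * (-d ^ 2 + 2 * β / 3) * w s) / ((w' s) ^ 2 + 4 * c ^ 2)) s := by
    intro s
    have hpole : d * c / (d * w s - r)
        = c * (-8 * (w s) ^ 2 + 4 * d ^ 2 * w s + 4 * d * r) / ((w' s) ^ 2 + 4 * c ^ 2) := by
      rw [div_eq_div_iff (hne s) (hQ s)]
      linear_combination c * hfactor s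
    have hone : 1 + (w' s / (2 * c)) ^ 2 = ((w' s) ^ 2 + 4 * c ^ 2) / (4 * c ^ 2) := by
      field_simp
      ring
    refine ((((hw' s).div_const (2 * c)).arctan).div_const 3).congr_deriv ?_
    have := hQ s
    rw [hpole, hone, hsecond s]
    field_simp
    ring
  have hw_cont : Continuous w := continuous_iff_continuousAt.2 fun s => (hw s).continuousAt
  have hw'_cont : Continuous w' := continuous_iff_continuousAt.2 fun s => (hw' s).continuousAt
  rw [intervalIntegral.integral_eq_sub_of_hasDerivAt (fun s _ => hprim s)]
  · simp [h0, hL]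
  · refine Continuous.intervalIntegrable ?_ _ _
    exact (continuous_const.div (by fun_prop) hne).add ((by fun_prop : Continuous _).div
      (by fun_prop) hQ)
end

section
/- Let Aff(ℂ) denote the group of affine transformations of ℂ, i.e. maps z ↦ az + b with a ∈ ℂ*, b ∈ ℂ (the semidirect product ℂ ⋊ ℂ*), with its natural topology. If G is a closed connected subgroup of Aff(ℂ) that acts transitively on ℂ, then there exists g ∈ Aff(ℂ) such that the conjugate g G g⁻¹ contains the subgroup of all translations {z ↦ z + b : b ∈ ℂ}. -/
theorem AffineEquiv.apply_eq_mul_add (g : ℂ ≃ᵃ[ℂ] ℂ) (z : ℂ) : g z = g.linear 1 * z + g 0 := by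
  have h := g.map_vadd 0 z
  have hz : g.linear z = z * g.linear 1 := by
    simpa using g.linear.map_smul z 1
  simp only [vadd_eq_add, add_zero] at h
  rw [h, hz, mul_comm]

/-- A transitive subgroup of the affine group of `ℂ` contains all translations: if some `k` in it
has a fixed point `p` and linear part `a ≠ 1`, then the commutator of `g` with `k` is the
translation by `(1 - a) * (g p - p)`. -/
theorem exists_translation_mem_of_transitive (G : Subgroup (ℂ ≃ᵃ[ℂ] ℂ))
    (htrans : ∀ z₁ z₂ : ℂ, ∃ g ∈ G, g z₁ = z₂) (b : ℂ) :
    ∃ g ∈ G, ∀ z : ℂ, g z = z + b := by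
  by_cases hlin : ∀ g ∈ G, g.linear 1 = 1
  · obtain ⟨g, hg, hgb⟩ := htrans 0 b
    exact ⟨g, hg, fun z => by rw [g.apply_eq_mul_add, hlin g hg, hgb, one_mul]⟩
  · push Not at hlin
    obtain ⟨k, hk, hk1⟩ := hlin
    have hne : 1 - k.linear 1 ≠ 0 := sub_ne_zero.mpr hk1.symm
    obtain ⟨g, hg, hgp⟩ := htrans (k 0 / (1 - k.linear 1)) ((k 0 + b) / (1 - k.linear 1))
    refine ⟨g * k * (k * g)⁻¹, G.mul_mem (G.mul_mem hg hk) (G.inv_mem (G.mul_mem hk hg)),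
      fun z => ?_⟩
    obtain ⟨w, rfl⟩ := (k * g).surjective z
    have hinv : (k * g)⁻¹ ((k * g) w) = w := (k * g).symm_apply_apply w
    simp only [AffineEquiv.coe_mul, Function.comp_apply] at hinv ⊢
    rw [hinv, g.apply_eq_mul_add (k w), k.apply_eq_mul_add (g w), k.apply_eq_mul_add w,
      g.apply_eq_mul_add w]
    rw [g.apply_eq_mul_add] at hgp
    field_simp at hgp
    linear_combination hgp


/-- If `G` is a closed connected subgroup of the affine group `Aff(ℂ)` (affine equivalences
`z ↦ az + b`, `a ≠ 0`, identified with the set `S` of coefficient pairs `(a,b)`, closedness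
being relative to `{a ≠ 0}`) acting transitively on `ℂ`, then some conjugate of `G`
contains all translations. -/
theorem stmt_18 (G : Subgroup (ℂ ≃ᵃ[ℂ] ℂ))
    (S : Set (ℂ × ℂ)) (hS : S = {p : ℂ × ℂ | ∃ g ∈ G, ∀ z : ℂ, g z = p.1 * z + p.2})
    (hclosed : ∀ p : ℂ × ℂ, p.1 ≠ 0 → p ∈ closure S → p ∈ S)
    (hconn : IsConnected S)
    (htrans : ∀ z₁ z₂ : ℂ, ∃ g ∈ G, g z₁ = z₂) :
    ∃ h : ℂ ≃ᵃ[ℂ] ℂ, ∀ b : ℂ, ∃ g ∈ G, ∀ z : ℂ, h (g (h.symm z)) = z + b := by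
  exact ⟨AffineEquiv.refl ℂ ℂ, fun b => exists_translation_mem_of_transitive G htrans b⟩
end
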